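/- arXiv:0904.0407 — 2 statements merged into one kernel-verified Lean document; each statement's English description precedes it below -/
import Mathlib

section
/- For every n ≥ 0, F_{2n+1}^I(x,y,q) = Σ_{j=0}^{n} x y^j q^{4nj − 2j² + 2n − 2j} F_{2n−2j}^I(x,y,q), as an identity in ℤ[x,y,q]. -/
open Finset MvPolynomial

open scoped Classical

/-- `σ` (a permutation of `[n]` in one-line notation `σ 0, …, σ (n-1)`) contains the
pattern `π` (given by its one-line notation as a function `Fin m → Fin m`) if some
subsequence of `σ` is order isomorphic to `π`. -/
def PermContains {n m : ℕ} (σ : Equiv.Perm (Fin n)) (π : Fin m → Fin m) : Prop :=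
  ∃ f : Fin m → Fin n, (∀ a b : Fin m, a < b → f a < f b) ∧
    ∀ a b : Fin m, σ (f a) < σ (f b) ↔ π a < π b

/-- `σ` avoids the pattern `π`. -/
def PermAvoids {n m : ℕ} (σ : Equiv.Perm (Fin n)) (π : Fin m → Fin m) : Prop :=
  ¬ PermContains σ π

/-- The value `σ i` of the one-line notation of `σ`, as a natural number (0-based). -/
def permVal {n : ℕ} (σ : Equiv.Perm (Fin n)) (i : ℕ) : ℕ :=
  if h : i < n then (σ ⟨i, h⟩ : ℕ) else 0

/-- `inv σ` : the number of inversions, i.e. pairs of positions `i < j` with `σ i > σ j`. -/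
def invStat {n : ℕ} (σ : Equiv.Perm (Fin n)) : ℕ :=
  ((Finset.range n ×ˢ Finset.range n).filter
    fun p => p.1 < p.2 ∧ permVal σ p.2 < permVal σ p.1).card

/-- `maj σ` : the sum of all (1-based) indices `i` with `σ(i) > σ(i+1)`; with 0-based
positions, a descent at positions `i, i+1` contributes `i + 1`. -/
def majStat {n : ℕ} (σ : Equiv.Perm (Fin n)) : ℕ :=
  ∑ i ∈ Finset.range (n - 1), if permVal σ (i + 1) < permVal σ i then i + 1 else 0

/-- The number of ascents of `σ`; for `σ ∈ Sₙ(123,132,213)` (a reverse layered matching)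
this equals `d σ`, the number of doubleton blocks. -/
def ascStat {n : ℕ} (σ : Equiv.Perm (Fin n)) : ℕ :=
  ((Finset.range (n - 1)).filter fun i => permVal σ i < permVal σ (i + 1)).card

/-- The number of descents of `σ`; for `σ ∈ Sₙ(231,312,321)` (a layered matching)
this equals `d σ`, the number of doubleton blocks. -/
def descStat {n : ℕ} (σ : Equiv.Perm (Fin n)) : ℕ :=
  ((Finset.range (n - 1)).filter fun i => permVal σ (i + 1) < permVal σ i).card

/-- `Sₙ(123, 132, 213)` : permutations of `[n]` avoiding `123`, `132` and `213`
(patterns written 0-based). -/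
noncomputable def S123 (n : ℕ) : Finset (Equiv.Perm (Fin n)) :=
  Finset.univ.filter fun σ =>
    PermAvoids σ ![0, 1, 2] ∧ PermAvoids σ ![0, 2, 1] ∧ PermAvoids σ ![1, 0, 2]

/-- `Sₙ(231, 312, 321)` : permutations of `[n]` avoiding `231`, `312` and `321`
(patterns written 0-based). -/
noncomputable def S231 (n : ℕ) : Finset (Equiv.Perm (Fin n)) :=
  Finset.univ.filter fun σ =>
    PermAvoids σ ![1, 2, 0] ∧ PermAvoids σ ![2, 0, 1] ∧ PermAvoids σ ![2, 1, 0]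

/-- `Fₙᴵ(x, y, q) = Σ_{σ ∈ Sₙ(123,132,213)} x^(s σ) * y^(d σ) * q^(inv σ)` in `ℤ[x,y,q]`,
where `d σ = ascStat σ` is the number of doubletons and `s σ = n - 2 * d σ` the number of
singletons; here `x = X 0`, `y = X 1`, `q = X 2`. -/
noncomputable def FI (n : ℕ) : MvPolynomial (Fin 3) ℤ :=
  ∑ σ ∈ S123 n, X 0 ^ (n - 2 * ascStat σ) * X 1 ^ ascStat σ * X 2 ^ invStat σ

theorem permVal_lt {n : ℕ} (σ : Equiv.Perm (Fin n)) {i : ℕ} (hi : i < n) : permVal σ i < n := by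
  simp [permVal, hi]

theorem permVal_inj {n : ℕ} (σ : Equiv.Perm (Fin n)) {i j : ℕ} (hi : i < n) (hj : j < n)
    (h : permVal σ i = permVal σ j) : i = j := by
  simpa [permVal, hi, hj, Fin.val_inj] using h

theorem exists_permVal_eq {n : ℕ} (σ : Equiv.Perm (Fin n)) {k : ℕ} (hk : k < n) :
    ∃ i < n, permVal σ i = k :=
  ⟨σ.symm ⟨k, hk⟩, (σ.symm ⟨k, hk⟩).2, by simp [permVal]⟩

theorem perm_ext_permVal {n : ℕ} {σ τ : Equiv.Perm (Fin n)}
    (h : ∀ i < n, permVal σ i = permVal τ i) : σ = τ := by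
  ext i
  simpa [permVal] using h i i.2

theorem exists_perm_of_injOn {n : ℕ} (f : ℕ → ℕ) (hf : ∀ i < n, f i < n)
    (hinj : ∀ i < n, ∀ j < n, f i = f j → i = j) :
    ∃ σ : Equiv.Perm (Fin n), ∀ i < n, permVal σ i = f i := by
  let g : Fin n → Fin n := fun i => ⟨f i, hf i i.2⟩
  have hg : Function.Injective g := fun i j h =>
    Fin.ext (hinj i i.2 j j.2 (congrArg Fin.val h))
  refine ⟨Equiv.ofBijective g (Finite.injective_iff_bijective.mp hg), fun i hi => ?_⟩
  simp [permVal, hi, g]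

/-- The patterns `123`, `132`, `213` are exactly those whose first entry is below the last. -/
theorem mem_S123_iff {n : ℕ} (σ : Equiv.Perm (Fin n)) :
    σ ∈ S123 n ↔ ∀ i j, i + 2 ≤ j → j < n → permVal σ j < permVal σ i := by
  rw [S123, Finset.mem_filter]
  simp only [Finset.mem_univ, true_and, PermAvoids, PermContains]
  constructor
  · rintro ⟨h₁, h₂, h₃⟩ i j hij hj
    by_contra hlt
    have hi : i < n := by omega
    have hm : i + 1 < n := by omega
    have hne : permVal σ i ≠ permVal σ j := fun h => by
      have := permVal_inj σ hi hj h
      omega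
    have hne₁ : permVal σ i ≠ permVal σ (i + 1) := fun h => by
      have := permVal_inj σ hi hm h
      omega
    have hne₂ : permVal σ (i + 1) ≠ permVal σ j := fun h => by
      have := permVal_inj σ hm hj h
      omega
    simp only [permVal, hi, hj, hm, dif_pos] at hlt hne hne₁ hne₂
    have hmono : ∀ a b : Fin 3, a < b →
        (![⟨i, hi⟩, ⟨i + 1, hm⟩, ⟨j, hj⟩] : Fin 3 → Fin n) a <
          (![⟨i, hi⟩, ⟨i + 1, hm⟩, ⟨j, hj⟩] : Fin 3 → Fin n) b := by
      intro a b hab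
      fin_cases a <;> fin_cases b <;> simp [Fin.lt_def] at hab ⊢ <;> omega
    rcases lt_or_gt_of_ne hne₁ with h | h
    · rcases lt_or_gt_of_ne hne₂ with h' | h'
      · refine h₁ ⟨_, hmono, fun a b => ?_⟩
        fin_cases a <;> fin_cases b <;> simp [-Fin.val_fin_lt, Fin.lt_def] <;> omega
      · refine h₂ ⟨_, hmono, fun a b => ?_⟩
        fin_cases a <;> fin_cases b <;> simp [-Fin.val_fin_lt, Fin.lt_def] <;> omega
    · refine h₃ ⟨_, hmono, fun a b => ?_⟩
      fin_cases a <;> fin_cases b <;> simp [-Fin.val_fin_lt, Fin.lt_def] <;> omega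
  · intro h
    have key : ∀ π : Fin 3 → Fin 3, π 0 < π 2 →
        ¬ ∃ f : Fin 3 → Fin n, (∀ a b : Fin 3, a < b → f a < f b) ∧
          ∀ a b : Fin 3, σ (f a) < σ (f b) ↔ π a < π b := by
      rintro π hπ ⟨f, hf, hσ⟩
      have h₀ := hf 0 1 (by decide)
      have h₁ := hf 1 2 (by decide)
      have h₂ := (hσ 0 2).2 hπ
      have := h (f 0) (f 2) (by simp only [Fin.lt_def] at h₀ h₁; omega) (f 2).2
      simp only [permVal, Fin.is_lt, dif_pos, Fin.eta, Fin.lt_def] at this h₂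
      omega
    exact ⟨key _ (by decide), key _ (by decide), key _ (by decide)⟩

theorem exists_blockExtend {n : ℕ} (k : ℕ) (τ : Equiv.Perm (Fin n)) :
    ∃ σ : Equiv.Perm (Fin (n + k)), ∀ i < n + k,
      permVal σ i = if i < n then permVal τ i + k else i - n := by
  apply exists_perm_of_injOn
  · intro i hi
    split_ifs with h
    · have := permVal_lt τ h
      omega
    · omega
  · intro i hi j hj hij
    split_ifs at hij with h h' h'
    · exact permVal_inj τ h h' (by omega)
    all_goals omega

/-- Append an increasing block of size `k` below and to the right of `τ`. -/
noncomputable def blockExtend {n : ℕ} (k : ℕ) (τ : Equiv.Perm (Fin n)) :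
    Equiv.Perm (Fin (n + k)) :=
  (exists_blockExtend k τ).choose

theorem permVal_blockExtend_of_lt {n : ℕ} (k : ℕ) (τ : Equiv.Perm (Fin n)) {i : ℕ} (hi : i < n) :
    permVal (blockExtend k τ) i = permVal τ i + k :=
  ((exists_blockExtend k τ).choose_spec i (by omega)).trans (if_pos hi)

theorem permVal_blockExtend_add {n : ℕ} (k : ℕ) (τ : Equiv.Perm (Fin n)) {i : ℕ} (hi : i < k) :
    permVal (blockExtend k τ) (n + i) = i :=
  ((exists_blockExtend k τ).choose_spec (n + i) (by omega)).trans
    ((if_neg (by omega)).trans (Nat.add_sub_cancel_left n i))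

theorem blockExtend_injective {n : ℕ} (k : ℕ) :
    Function.Injective (blockExtend k : Equiv.Perm (Fin n) → Equiv.Perm (Fin (n + k))) := by
  intro σ τ h
  refine perm_ext_permVal fun i hi => ?_
  have := congrArg (fun ρ => permVal ρ i) h
  simpa [permVal_blockExtend_of_lt k _ hi] using this

theorem exists_blockExtend_eq {n k : ℕ} (σ : Equiv.Perm (Fin (n + k)))
    (h : ∀ i < k, permVal σ (n + i) = i) : ∃ τ : Equiv.Perm (Fin n), blockExtend k τ = σ := by
  have hk : ∀ i < n, k ≤ permVal σ i := by
    intro i hi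
    by_contra hlt
    have := permVal_inj σ (by omega) (by omega) (h (permVal σ i) (by omega))
    omega
  obtain ⟨τ, hτ⟩ := exists_perm_of_injOn (n := n) (fun i => permVal σ i - k)
    (fun i hi => by
      have := permVal_lt σ (i := i) (by omega)
      have := hk i hi
      omega)
    (fun i hi j hj hij => by
      have := hk i hi
      have := hk j hj
      exact permVal_inj σ (by omega) (by omega) (by omega))
  refine ⟨τ, perm_ext_permVal fun i hi => ?_⟩
  by_cases hin : i < n
  · rw [permVal_blockExtend_of_lt k τ hin, hτ i hin]
    exact Nat.sub_add_cancel (hk i hin)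
  · obtain ⟨j, rfl⟩ := Nat.exists_eq_add_of_le (not_lt.mp hin)
    rw [permVal_blockExtend_add k τ (by omega), h j (by omega)]

theorem blockExtend_mem_S123_iff {n k : ℕ} (hk : k ≤ 2) (τ : Equiv.Perm (Fin n)) :
    blockExtend k τ ∈ S123 (n + k) ↔ τ ∈ S123 n := by
  rw [mem_S123_iff, mem_S123_iff]
  constructor
  · intro h i j hij hj
    have := h i j hij (by omega)
    rw [permVal_blockExtend_of_lt k τ hj, permVal_blockExtend_of_lt k τ (by omega)] at this
    omega
  · intro h i j hij hj
    have hi : i < n := by omega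
    rw [permVal_blockExtend_of_lt k τ hi]
    by_cases hjn : j < n
    · rw [permVal_blockExtend_of_lt k τ hjn]
      have := h i j hij hjn
      omega
    · obtain ⟨l, rfl⟩ := Nat.exists_eq_add_of_le (not_lt.mp hjn)
      rw [permVal_blockExtend_add k τ (by omega)]
      omega

theorem invStat_eq_sum {n : ℕ} (σ : Equiv.Perm (Fin n)) :
    invStat σ = ∑ j ∈ Finset.range n, ∑ i ∈ Finset.range j,
      if permVal σ j < permVal σ i then 1 else 0 := by
  rw [invStat, Finset.card_filter, Finset.sum_product_right]
  refine Finset.sum_congr rfl fun j hj => ?_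
  rw [Finset.mem_range] at hj
  rw [← Finset.sum_subset (Finset.range_subset_range.2 hj.le)]
  · refine Finset.sum_congr rfl fun i hi => ?_
    simp [Finset.mem_range.1 hi]
  · intro i _ hi
    simp only [Finset.mem_range] at hi
    simp [hi]

theorem invStat_blockExtend {n : ℕ} (k : ℕ) (τ : Equiv.Perm (Fin n)) :
    invStat (blockExtend k τ) = invStat τ + k * n := by
  rw [invStat_eq_sum, invStat_eq_sum, Finset.sum_range_add]
  congr 1
  · refine Finset.sum_congr rfl fun j hj => Finset.sum_congr rfl fun i hi => ?_
    rw [Finset.mem_range] at hi hj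
    simp [permVal_blockExtend_of_lt k τ hj, permVal_blockExtend_of_lt k τ (hi.trans hj)]
  · rw [← smul_eq_mul, ← Finset.card_range k, ← Finset.sum_const, Finset.card_range k]
    refine Finset.sum_congr rfl fun j hj => ?_
    rw [Finset.mem_range] at hj
    rw [Finset.sum_range_add, Finset.sum_eq_zero (s := Finset.range j), add_zero]
    · rw [Finset.sum_congr rfl (g := fun _ => 1)]
      · simp
      · intro i hi
        rw [permVal_blockExtend_of_lt k τ (Finset.mem_range.1 hi), permVal_blockExtend_add k τ hj,
          if_pos (by omega)]
    · intro i hi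
      rw [Finset.mem_range] at hi
      rw [permVal_blockExtend_add k τ hj, permVal_blockExtend_add k τ (hi.trans hj),
        if_neg (by omega)]

theorem ascStat_blockExtend {n : ℕ} (k : ℕ) (τ : Equiv.Perm (Fin n)) :
    ascStat (blockExtend (k + 1) τ) = ascStat τ + k := by
  have hlast : ∀ i < k, permVal (blockExtend (k + 1) τ) (n + i) <
      permVal (blockExtend (k + 1) τ) (n + i + 1) := by
    intro i hi
    rw [permVal_blockExtend_add _ τ (by omega), add_assoc, permVal_blockExtend_add _ τ (by omega)]
    omega
  rw [ascStat, ascStat, Finset.card_filter, Finset.card_filter,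
    show n + (k + 1) - 1 = n + k by omega, Finset.sum_range_add]
  congr 1
  · cases n with
    | zero => simp
    | succ m =>
      rw [Finset.sum_range_succ, if_neg, add_zero]
      · refine Finset.sum_congr rfl fun i hi => ?_
        rw [Finset.mem_range] at hi
        rw [permVal_blockExtend_of_lt _ τ (by omega), permVal_blockExtend_of_lt _ τ (by omega)]
        simp
      · rw [permVal_blockExtend_of_lt _ τ (by omega)]
        have := permVal_blockExtend_add (k + 1) τ (i := 0) (by omega)
        rw [add_zero] at this
        omega
  · rw [Finset.sum_congr rfl (g := fun _ => 1)]
    · simp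
    · intro i hi
      rw [if_pos (hlast i (Finset.mem_range.1 hi))]

theorem exists_blockExtend_one_eq {n : ℕ} {σ : Equiv.Perm (Fin (n + 1))}
    (hσ : σ ∈ S123 (n + 1)) (h : permVal σ n = 0) : ∃ τ ∈ S123 n, blockExtend 1 τ = σ := by
  obtain ⟨τ, rfl⟩ := exists_blockExtend_eq σ (fun i hi => by
    obtain rfl : i = 0 := by omega
    exact h)
  exact ⟨τ, (blockExtend_mem_S123_iff (by omega) τ).1 hσ, rfl⟩

theorem exists_blockExtend_two_eq {n : ℕ} {σ : Equiv.Perm (Fin (n + 2))}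
    (hσ : σ ∈ S123 (n + 2)) (h : permVal σ (n + 1) ≠ 0) :
    ∃ τ ∈ S123 n, blockExtend 2 τ = σ := by
  have hlt : ∀ i < n, permVal σ (n + 1) < permVal σ i := fun i hi =>
    (mem_S123_iff σ).1 hσ i (n + 1) (by omega) (by omega)
  have h₀ : permVal σ n = 0 := by
    obtain ⟨i, hi, hi₀⟩ := exists_permVal_eq σ (k := 0) (by omega)
    rcases lt_trichotomy i n with hin | rfl | hin
    · have := hlt i hin
      omega
    · exact hi₀
    · obtain rfl : i = n + 1 := by omega
      exact absurd hi₀ h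
  have h₁ : permVal σ (n + 1) = 1 := by
    obtain ⟨i, hi, hi₁⟩ := exists_permVal_eq σ (k := 1) (by omega)
    rcases lt_trichotomy i n with hin | rfl | hin
    · have := hlt i hin
      omega
    · omega
    · obtain rfl : i = n + 1 := by omega
      exact hi₁
  obtain ⟨τ, rfl⟩ := exists_blockExtend_eq σ (fun i hi => by
    obtain rfl | rfl : i = 0 ∨ i = 1 := by omega
    · exact h₀
    · exact h₁)
  exact ⟨τ, (blockExtend_mem_S123_iff le_rfl τ).1 hσ, rfl⟩

theorem two_mul_ascStat_le {n : ℕ} (σ : Equiv.Perm (Fin n)) (hσ : σ ∈ S123 n) :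
    2 * ascStat σ ≤ n := by
  induction n using Nat.strong_induction_on with
  | _ n ih =>
    match n with
    | 0 => simp [ascStat]
    | 1 => simp [ascStat]
    | m + 2 =>
      by_cases h : permVal σ (m + 1) = 0
      · obtain ⟨τ, hτ, rfl⟩ := exists_blockExtend_one_eq hσ h
        have := ih (m + 1) (by omega) τ hτ
        have : ascStat (blockExtend 1 τ) = ascStat τ := ascStat_blockExtend 0 τ
        omega
      · obtain ⟨τ, hτ, rfl⟩ := exists_blockExtend_two_eq hσ h
        have := ih m (by omega) τ hτ
        have : ascStat (blockExtend 2 τ) = ascStat τ + 1 := ascStat_blockExtend 1 τ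
        omega

theorem FI_add_two (n : ℕ) :
    FI (n + 2) = X 0 * X 2 ^ (n + 1) * FI (n + 1) + X 1 * X 2 ^ (2 * n) * FI n := by
  rw [FI, ← Finset.sum_filter_add_sum_filter_not (S123 (n + 2))
    (fun σ => permVal σ (n + 1) = 0), FI, FI, Finset.mul_sum, Finset.mul_sum]
  congr 1
  · symm
    refine Finset.sum_bij (fun τ _ => blockExtend 1 τ) ?_ ?_ ?_ ?_
    · intro τ hτ
      exact Finset.mem_filter.2 ⟨(blockExtend_mem_S123_iff one_le_two τ).2 hτ,
        permVal_blockExtend_add 1 τ (i := 0) (by omega)⟩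
    · exact fun τ _ τ' _ h => blockExtend_injective 1 h
    · intro σ hσ
      obtain ⟨hσ, h⟩ := Finset.mem_filter.1 hσ
      obtain ⟨τ, hτ, rfl⟩ := exists_blockExtend_one_eq hσ h
      exact ⟨τ, hτ, rfl⟩
    · intro τ hτ
      have hle := two_mul_ascStat_le τ hτ
      have hasc : ascStat (blockExtend 1 τ) = ascStat τ := ascStat_blockExtend 0 τ
      rw [hasc, invStat_blockExtend,
        show n + 2 - 2 * ascStat τ = (n + 1 - 2 * ascStat τ) + 1 by omega]
      ring
  · symm
    refine Finset.sum_bij (fun τ _ => blockExtend 2 τ) ?_ ?_ ?_ ?_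
    · intro τ hτ
      refine Finset.mem_filter.2 ⟨(blockExtend_mem_S123_iff le_rfl τ).2 hτ, ?_⟩
      rw [permVal_blockExtend_add 2 τ (i := 1) (by omega)]
      exact one_ne_zero
    · exact fun τ _ τ' _ h => blockExtend_injective 2 h
    · intro σ hσ
      obtain ⟨hσ, h⟩ := Finset.mem_filter.1 hσ
      obtain ⟨τ, hτ, rfl⟩ := exists_blockExtend_two_eq hσ h
      exact ⟨τ, hτ, rfl⟩
    · intro τ hτ
      have hasc : ascStat (blockExtend 2 τ) = ascStat τ + 1 := ascStat_blockExtend 1 τ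
      rw [hasc, invStat_blockExtend,
        show n + 2 - 2 * (ascStat τ + 1) = n - 2 * ascStat τ by omega]
      ring

theorem FI_zero : FI 0 = 1 := by
  have h : S123 0 = Finset.univ := Finset.eq_univ_of_forall fun σ =>
    (mem_S123_iff σ).2 fun i j _ hj => by omega
  simp [FI, h, ascStat, invStat_eq_sum]

theorem FI_one : FI 1 = X 0 := by
  have h : S123 1 = Finset.univ := Finset.eq_univ_of_forall fun σ =>
    (mem_S123_iff σ).2 fun i j _ hj => by omega
  simp [FI, h, ascStat, invStat_eq_sum]

/-- `F_{2n+1}ᴵ = Σ_{j=0}^{n} x yʲ q^(4nj - 2j² + 2n - 2j) F_{2n-2j}ᴵ` in `ℤ[x,y,q]`. -/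
theorem stmt15 (n : ℕ) :
    FI (2 * n + 1) = ∑ j ∈ Finset.range (n + 1),
      X 0 * X 1 ^ j * X 2 ^ (4 * n * j - 2 * j ^ 2 + 2 * n - 2 * j) * FI (2 * n - 2 * j) := by
  induction n with
  | zero => simp [FI_zero, FI_one]
  | succ m ih =>
    rw [Finset.sum_range_succ', show 2 * (m + 1) + 1 = (2 * m + 1) + 2 by ring, FI_add_two, ih,
      Finset.mul_sum, add_comm (X 0 * _ * _)]
    refine congrArg₂ (· + ·) ?_ ?_
    · refine Finset.sum_congr rfl fun j hj => ?_
      obtain ⟨k, rfl⟩ := Nat.exists_eq_add_of_le (Nat.lt_succ_iff.1 (Finset.mem_range.1 hj))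
      have hsub : ∀ a b : ℕ, 4 * (a + b) * a - 2 * a ^ 2 + 2 * (a + b) - 2 * a =
          2 * a ^ 2 + 4 * a * b + 2 * b := by
        intro a b
        have : 4 * (a + b) * a = 2 * a ^ 2 + 4 * a * b + 2 * a ^ 2 := by ring
        omega
      rw [show j + k + 1 = (j + 1) + k by ring, hsub, hsub,
        show 2 * (j + 1 + k) - 2 * (j + 1) = 2 * k by omega,
        show 2 * (j + k) - 2 * j = 2 * k by omega]
      ring
    · simp [mul_add]
end

section
/- Define V_n(q) = Σ_{σ ∈ S_n(132,3412)} q^{inv(σ)} in ℤ[q]. Then V_0 = V_1 = 1 and, for every n ≥ 2, V_n(q) = (q^{n−1} + 1)·V_{n−1}(q) + Σ_{k=2}^{n−1} q^{k(n−k) + C(n−k,2)} V_{k−1}(q), where C(n−k,2) = (n−k)(n−k−1)/2. -/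
open Finset MvPolynomial

open scoped Classical

/-- `Sₙ(132, 3412)` : permutations of `[n]` avoiding `132` and `3412`
(patterns written 0-based). -/
noncomputable def S132_3412 (n : ℕ) : Finset (Equiv.Perm (Fin n)) :=
  Finset.univ.filter fun σ => PermAvoids σ ![0, 2, 1] ∧ PermAvoids σ ![2, 3, 0, 1]

/-- `Vₙ(q) = Σ_{σ ∈ Sₙ(132,3412)} q^(inv σ)` in `ℤ[q]`. -/
noncomputable def V (n : ℕ) : Polynomial ℤ := ∑ σ ∈ S132_3412 n, Polynomial.X ^ invStat σ

namespace PatternAvoid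

lemma permVal_of_lt {n : ℕ} (σ : Equiv.Perm (Fin n)) {i : ℕ} (h : i < n) :
    permVal σ i = (σ ⟨i, h⟩ : ℕ) := by
  simp [permVal, h]

lemma permVal_lt {n : ℕ} (σ : Equiv.Perm (Fin n)) {i : ℕ} (h : i < n) : permVal σ i < n := by
  rw [permVal_of_lt σ h]
  exact (σ ⟨i, h⟩).2

lemma permVal_inj {n : ℕ} (σ : Equiv.Perm (Fin n)) {i j : ℕ} (hi : i < n) (hj : j < n)
    (h : permVal σ i = permVal σ j) : i = j := by
  rw [permVal_of_lt σ hi, permVal_of_lt σ hj] at h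
  simpa using σ.injective (Fin.ext h)

lemma exists_permVal_eq {n : ℕ} (σ : Equiv.Perm (Fin n)) {a : ℕ} (h : a < n) :
    ∃ i < n, permVal σ i = a := by
  refine ⟨σ.symm ⟨a, h⟩, (σ.symm ⟨a, h⟩).2, ?_⟩
  rw [permVal_of_lt σ (σ.symm ⟨a, h⟩).2]
  simp

lemma perm_ext_permVal {n : ℕ} {σ τ : Equiv.Perm (Fin n)}
    (h : ∀ i < n, permVal σ i = permVal τ i) : σ = τ := by
  ext i
  simpa [permVal_of_lt _ i.2] using h i i.2

lemma exists_perm_of_injOn {n : ℕ} (f : ℕ → ℕ) (hlt : ∀ i < n, f i < n)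
    (hinj : ∀ i < n, ∀ j < n, f i = f j → i = j) :
    ∃ σ : Equiv.Perm (Fin n), ∀ i < n, permVal σ i = f i := by
  have hbij : Function.Bijective (fun i : Fin n => (⟨f i, hlt i i.2⟩ : Fin n)) := by
    refine Finite.injective_iff_bijective.mp fun i j hij => ?_
    exact Fin.ext (hinj i i.2 j j.2 (by simpa using hij))
  refine ⟨Equiv.ofBijective _ hbij, fun i hi => ?_⟩
  rw [permVal_of_lt _ hi]
  rfl

/-- The first `n` terms of `v` avoid both `132` and `3412`. -/
def Avoids (v : ℕ → ℕ) (n : ℕ) : Prop :=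
  (∀ i j k, i < j → j < k → k < n → v i < v k → v k < v j → False) ∧
  ∀ i j k l, i < j → j < k → k < l → l < n → v k < v l → v l < v i → v i < v j → False

lemma mem_S132_3412_iff {n : ℕ} {σ : Equiv.Perm (Fin n)} :
    σ ∈ S132_3412 n ↔ Avoids (permVal σ) n := by
  rw [S132_3412, mem_filter]
  simp only [mem_univ, true_and, Avoids, PermAvoids, PermContains]
  refine and_congr (Iff.intro (fun h i j k hij hjk hk h1 h2 => ?_) ?_)
    (Iff.intro (fun h i j k l hij hjk hkl hl h1 h2 h3 => ?_) ?_)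
  · rw [permVal_of_lt σ (by omega), permVal_of_lt σ (by omega)] at h1 h2
    refine h ⟨![⟨i, by omega⟩, ⟨j, by omega⟩, ⟨k, hk⟩], ?_, ?_⟩
    · simp [Fin.forall_fin_succ]; omega
    · simp [Fin.forall_fin_succ]; simp only [Fin.lt_def]; omega
  · rintro h ⟨f, hf, hp⟩
    refine h (f 0) (f 1) (f 2) (hf 0 1 (by decide)) (hf 1 2 (by decide)) (f 2).2 ?_ ?_
    · simpa [permVal] using (hp 0 2).2 (by decide)
    · simpa [permVal] using (hp 2 1).2 (by decide)
  · rw [permVal_of_lt σ (by omega), permVal_of_lt σ (by omega)] at h1 h2 h3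
    refine h ⟨![⟨i, by omega⟩, ⟨j, by omega⟩, ⟨k, by omega⟩, ⟨l, hl⟩], ?_, ?_⟩
    · simp [Fin.forall_fin_succ]; omega
    · simp [Fin.forall_fin_succ]; simp only [Fin.lt_def]; omega
  · rintro h ⟨f, hf, hp⟩
    refine h (f 0) (f 1) (f 2) (f 3) (hf 0 1 (by decide)) (hf 1 2 (by decide))
      (hf 2 3 (by decide)) (f 3).2 ?_ ?_ ?_
    · simpa [permVal] using (hp 2 3).2 (by decide)
    · simpa [permVal] using (hp 3 0).2 (by decide)
    · simpa [permVal] using (hp 0 1).2 (by decide)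

lemma invStat_eq_sum {n : ℕ} (σ : Equiv.Perm (Fin n)) :
    invStat σ = ∑ j ∈ range n, #{i ∈ range j | permVal σ j < permVal σ i} := by
  rw [invStat, card_eq_sum_card_fiberwise (f := Prod.snd) (t := range n)
    (fun p hp => by simp at hp ⊢; omega)]
  refine sum_congr rfl fun j hj => ?_
  refine card_bij' (fun p _ => p.1) (fun i _ => (i, j)) ?_ ?_ ?_ ?_
  · rintro ⟨a, b⟩ h
    simp at h ⊢
    grind
  · intro i hi
    simp at hi hj ⊢
    omega
  · rintro ⟨a, b⟩ h
    simp at h ⊢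
    exact h.2.symm
  · simp

lemma card_le_permVal {n : ℕ} (σ : Equiv.Perm (Fin n)) {j : ℕ} (A : Finset ℕ)
    (hA : ∀ a ∈ A, a < n ∧ permVal σ a < permVal σ j) : #A ≤ permVal σ j := by
  simpa using card_le_card_of_injOn (t := range (permVal σ j)) (permVal σ)
    (fun a ha => by simpa using (hA a ha).2)
    (fun a ha b hb h => permVal_inj σ (hA a ha).1 (hA b hb).1 h)

lemma card_add_permVal_lt {n : ℕ} (σ : Equiv.Perm (Fin n)) {j : ℕ} (hj : j < n) (A : Finset ℕ)
    (hA : ∀ a ∈ A, a < n ∧ permVal σ j < permVal σ a) : #A + permVal σ j < n := by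
  have h := card_le_card_of_injOn (s := A) (t := Ioo (permVal σ j) n) (permVal σ)
    (fun a ha => by simpa using ⟨(hA a ha).2, permVal_lt σ (hA a ha).1⟩)
    (fun a ha b hb h => permVal_inj σ (hA a ha).1 (hA b hb).1 h)
  have := permVal_lt σ hj
  simp at h
  omega

/-- `σ` is the one-line notation of `τ`, preceded by the maximum. -/
def IsMaxCons {m : ℕ} (τ : Equiv.Perm (Fin m)) (σ : Equiv.Perm (Fin (m + 1))) : Prop :=
  permVal σ 0 = m ∧ ∀ i < m, permVal σ (i + 1) = permVal τ i

/-- `σ` is the one-line notation of `τ`, raised by `r`, followed by the maximum and then by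
`r - 1, …, 1, 0`. -/
def IsMaxDecr {m r : ℕ} (τ : Equiv.Perm (Fin m)) (σ : Equiv.Perm (Fin (m + 1 + r))) : Prop :=
  (∀ i < m, permVal σ i = permVal τ i + r) ∧ permVal σ m = m + r ∧
    ∀ i < m + 1 + r, m < i → permVal σ i = m + r - i

lemma exists_isMaxCons {m : ℕ} (τ : Equiv.Perm (Fin m)) : ∃ σ, IsMaxCons τ σ := by
  have hlt := fun i => permVal_lt τ (i := i)
  have hinj := fun i j => permVal_inj τ (i := i) (j := j)
  obtain ⟨σ, hσ⟩ := exists_perm_of_injOn (n := m + 1)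
    (fun i => if i = 0 then m else permVal τ (i - 1)) (by grind) (by grind)
  exact ⟨σ, by grind [IsMaxCons]⟩

lemma exists_isMaxDecr {m : ℕ} (r : ℕ) (τ : Equiv.Perm (Fin m)) :
    ∃ σ, IsMaxDecr (r := r) τ σ := by
  have hlt := fun i => permVal_lt τ (i := i)
  have hinj := fun i j => permVal_inj τ (i := i) (j := j)
  obtain ⟨σ, hσ⟩ := exists_perm_of_injOn (n := m + 1 + r)
    (fun i => if i < m then permVal τ i + r else if i = m then m + r else m + r - i)
    (by grind) (by grind)
  exact ⟨σ, by grind [IsMaxDecr]⟩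

lemma IsMaxCons.avoids_iff {m : ℕ} {τ : Equiv.Perm (Fin m)} {σ : Equiv.Perm (Fin (m + 1))}
    (h : IsMaxCons τ σ) : Avoids (permVal σ) (m + 1) ↔ Avoids (permVal τ) m := by
  have hlt := fun i => permVal_lt τ (i := i)
  obtain ⟨h0, h1⟩ := h
  constructor
  · rintro ⟨ha, hb⟩
    refine ⟨fun i j k hij hjk hk => ?_, fun i j k l hij hjk hkl hl => ?_⟩
    · have := ha (i + 1) (j + 1) (k + 1)
      grind
    · have := hb (i + 1) (j + 1) (k + 1) (l + 1)
      grind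
  · rintro ⟨ha, hb⟩
    have hle : ∀ i < m + 1, permVal σ i ≤ m := fun i hi =>
      Nat.lt_succ_iff.mp (permVal_lt σ hi)
    refine ⟨fun i j k hij hjk hk h2 h3 => ?_, fun i j k l hij hjk hkl hl h2 h3 h4 => ?_⟩
    · rcases i with _ | i
      · have := hle k hk
        omega
      obtain ⟨j, rfl⟩ := Nat.exists_eq_succ_of_ne_zero (n := j) (by omega)
      obtain ⟨k, rfl⟩ := Nat.exists_eq_succ_of_ne_zero (n := k) (by omega)
      have := ha i j k
      grind
    · rcases i with _ | i
      · have := hle j (by omega)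
        omega
      obtain ⟨j, rfl⟩ := Nat.exists_eq_succ_of_ne_zero (n := j) (by omega)
      obtain ⟨k, rfl⟩ := Nat.exists_eq_succ_of_ne_zero (n := k) (by omega)
      obtain ⟨l, rfl⟩ := Nat.exists_eq_succ_of_ne_zero (n := l) (by omega)
      have := hb i j k l
      grind

lemma IsMaxDecr.avoids_iff {m r : ℕ} {τ : Equiv.Perm (Fin m)}
    {σ : Equiv.Perm (Fin (m + 1 + r))} (h : IsMaxDecr τ σ) :
    Avoids (permVal σ) (m + 1 + r) ↔ Avoids (permVal τ) m := by
  have hlt := fun i => permVal_lt τ (i := i)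
  obtain ⟨h0, h1, h2⟩ := h
  constructor
  · rintro ⟨ha, hb⟩
    refine ⟨fun i j k hij hjk hk => ?_, fun i j k l hij hjk hkl hl => ?_⟩
    · have := ha i j k
      grind
    · have := hb i j k l
      grind
  · rintro ⟨ha, hb⟩
    have key : ∀ i j, i < j → j < m + 1 + r → permVal σ i < permVal σ j →
        j ≤ m ∧ (j < m → permVal τ i < permVal τ j) := by
      grind
    have hmax : ∀ i < m + 1 + r, permVal σ i ≤ m + r := fun i hi => by
      have := permVal_lt σ hi
      omega
    refine ⟨fun i j k hij hjk hk h3 h4 => ?_, fun i j k l hij hjk hkl hl h3 h4 h5 => ?_⟩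
    · have := key i k (by omega) hk h3
      have := ha i j k hij hjk
      have := hmax j (by omega)
      grind
    · have := key k l hkl hl h3
      have := hb i j k l hij hjk hkl
      have := hmax i (by omega)
      grind

lemma IsMaxCons.invStat_eq {m : ℕ} {τ : Equiv.Perm (Fin m)} {σ : Equiv.Perm (Fin (m + 1))}
    (h : IsMaxCons τ σ) : invStat σ = m + invStat τ := by
  obtain ⟨h0, h1⟩ := h
  rw [invStat_eq_sum, invStat_eq_sum, sum_range_succ']
  have hstep : ∀ j ∈ range m, #{i ∈ range (j + 1) | permVal σ (j + 1) < permVal σ i} =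
      1 + #{i ∈ range j | permVal τ j < permVal τ i} := by
    intro j hj
    rw [mem_range] at hj
    have hlt := permVal_lt τ hj
    simp only [card_filter]
    rw [sum_range_succ', h0, h1 j hj, if_pos hlt, add_comm]
    congr 1
    refine sum_congr rfl fun i hi => ?_
    rw [mem_range] at hi
    rw [h1 i (by omega)]
  rw [sum_congr rfl hstep, sum_add_distrib]
  simp

lemma IsMaxDecr.invStat_eq {m r : ℕ} {τ : Equiv.Perm (Fin m)}
    {σ : Equiv.Perm (Fin (m + 1 + r))} (h : IsMaxDecr τ σ) :
    invStat σ = (m + 1) * r + r.choose 2 + invStat τ := by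
  have hlt := fun i => permVal_lt τ (i := i)
  obtain ⟨h0, h1, h2⟩ := h
  rw [invStat_eq_sum, invStat_eq_sum, sum_range_add, sum_range_succ]
  have hleft : ∀ j ∈ range m, #{i ∈ range j | permVal σ j < permVal σ i} =
      #{i ∈ range j | permVal τ j < permVal τ i} := by
    intro j hj
    rw [mem_range] at hj
    congr 1
    refine filter_congr fun i hi => ?_
    rw [mem_range] at hi
    rw [h0 j hj, h0 i (by omega)]
    omega
  have hmid : #{i ∈ range m | permVal σ m < permVal σ i} = 0 := by
    rw [card_eq_zero, filter_eq_empty_iff]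
    grind
  have hright : ∀ j ∈ range r,
      #{i ∈ range (m + 1 + j) | permVal σ (m + 1 + j) < permVal σ i} = m + 1 + j := by
    intro j hj
    rw [mem_range] at hj
    rw [filter_true_of_mem, card_range]
    grind
  rw [sum_congr rfl hleft, hmid, sum_congr rfl hright, sum_add_distrib, sum_range_id,
    Nat.choose_two_right]
  simp
  ring

lemma exists_isMaxCons_of_permVal {m : ℕ} {σ : Equiv.Perm (Fin (m + 1))}
    (h : permVal σ 0 = m) : ∃ τ : Equiv.Perm (Fin m), IsMaxCons τ σ := by
  have hlt := fun i => permVal_lt σ (i := i)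
  have hinj := fun i j => permVal_inj σ (i := i) (j := j)
  obtain ⟨τ, hτ⟩ := exists_perm_of_injOn (n := m) (fun i => permVal σ (i + 1))
    (fun i hi => by
      have := hlt (i + 1) (by omega)
      have := hinj (i + 1) 0 (by omega) (by omega)
      grind)
    (fun i hi j hj hij => by
      have := hinj (i + 1) (j + 1) (by omega) (by omega) hij
      omega)
  exact ⟨τ, h, fun i hi => (hτ i hi).symm⟩

lemma exists_isMaxDecr_of_permVal {m r : ℕ} (hm : 0 < m) {σ : Equiv.Perm (Fin (m + 1 + r))}
    (h : permVal σ m = m + r) (hσ : Avoids (permVal σ) (m + 1 + r)) :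
    ∃ τ : Equiv.Perm (Fin m), IsMaxDecr τ σ := by
  have hlt := fun i => permVal_lt σ (i := i)
  have hinj := fun i j => permVal_inj σ (i := i) (j := j)
  obtain ⟨ha, hb⟩ := hσ
  have hmax : ∀ i < m + 1 + r, i ≠ m → permVal σ i < permVal σ m := by
    intro i hi him
    have := hlt i hi
    have := hinj i m hi (by omega)
    omega
  have hLR : ∀ i < m, ∀ j < m + 1 + r, m < j → permVal σ j < permVal σ i := by
    intro i hi j hj hmj
    have := ha i m j hi hmj hj
    have := hmax j hj (by omega)
    have := hinj i j (by omega) hj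
    grind
  have hRR : ∀ i < m + 1 + r, ∀ j < i, m < j → permVal σ i < permVal σ j := by
    intro i hi j hj hmj
    have := hb 0 m j i hm hmj hj hi
    have := hLR 0 hm i hi (by omega)
    have := hmax 0 (by omega) (by omega)
    have := hinj i j hi (by omega)
    grind
  have hL : ∀ i < m, r ≤ permVal σ i := by
    intro i hi
    have := card_le_permVal σ (j := i) (Ioo m (m + 1 + r)) (by grind)
    simp at this
    omega
  have hR : ∀ i < m + 1 + r, m < i → permVal σ i = m + r - i := by
    intro i hi hmi
    have h3 := card_le_permVal σ (j := i) (Ioo i (m + 1 + r)) (by grind)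
    have h4 := card_add_permVal_lt σ hi (range i) (by grind)
    simp at h3 h4
    omega
  obtain ⟨τ, hτ⟩ := exists_perm_of_injOn (n := m) (fun i => permVal σ i - r)
    (fun i hi => by
      have := hmax i (by omega) (by omega)
      have := hL i hi
      omega)
    (fun i hi j hj hij => by
      have := hL i hi
      have := hL j hj
      exact hinj i j (by omega) (by omega) (by omega))
  exact ⟨τ, by grind, h, hR⟩

lemma sum_maxCons (m : ℕ) :
    ∑ σ ∈ S132_3412 (m + 1) with permVal σ 0 = m, (Polynomial.X : Polynomial ℤ) ^ invStat σ =
      Polynomial.X ^ m * V m := by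
  choose f hf using exists_isMaxCons (m := m)
  rw [V, mul_sum]
  symm
  refine sum_bij (fun τ _ => f τ) ?_ ?_ ?_ ?_
  · intro τ hτ
    rw [mem_filter, mem_S132_3412_iff, (hf τ).avoids_iff]
    exact ⟨mem_S132_3412_iff.mp hτ, (hf τ).1⟩
  · intro τ _ τ' _ h
    refine perm_ext_permVal fun i hi => ?_
    rw [← (hf τ).2 i hi, ← (hf τ').2 i hi, h]
  · intro σ hσ
    rw [mem_filter, mem_S132_3412_iff] at hσ
    obtain ⟨τ, hτ⟩ := exists_isMaxCons_of_permVal hσ.2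
    refine ⟨τ, mem_S132_3412_iff.mpr (hτ.avoids_iff.mp hσ.1), perm_ext_permVal ?_⟩
    rintro (_ | i) hi
    · rw [hτ.1, (hf τ).1]
    · rw [hτ.2 i (by omega), (hf τ).2 i (by omega)]
  · intro τ _
    rw [(hf τ).invStat_eq, pow_add]

lemma sum_maxDecr {m : ℕ} (r : ℕ) (hm : 0 < m) :
    ∑ σ ∈ S132_3412 (m + 1 + r) with permVal σ m = m + r,
        (Polynomial.X : Polynomial ℤ) ^ invStat σ =
      Polynomial.X ^ ((m + 1) * r + r.choose 2) * V m := by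
  choose f hf using exists_isMaxDecr (m := m) r
  rw [V, mul_sum]
  symm
  refine sum_bij (fun τ _ => f τ) ?_ ?_ ?_ ?_
  · intro τ hτ
    rw [mem_filter, mem_S132_3412_iff, (hf τ).avoids_iff]
    exact ⟨mem_S132_3412_iff.mp hτ, (hf τ).2.1⟩
  · intro τ _ τ' _ h
    refine perm_ext_permVal fun i hi => ?_
    have h1 := (hf τ).1 i hi
    have h2 := (hf τ').1 i hi
    rw [h] at h1
    omega
  · intro σ hσ
    rw [mem_filter, mem_S132_3412_iff] at hσ
    obtain ⟨τ, hτ⟩ := exists_isMaxDecr_of_permVal hm hσ.2 hσ.1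
    refine ⟨τ, mem_S132_3412_iff.mpr (hτ.avoids_iff.mp hσ.1), perm_ext_permVal fun i hi => ?_⟩
    have := hf τ
    grind [IsMaxDecr]
  · intro τ _
    rw [(hf τ).invStat_eq, pow_add _ (_ + _)]

/-- Splitting `V (n + 1)` according to the position of the maximum. -/
lemma V_succ_eq_sum (n : ℕ) :
    V (n + 1) = ∑ k ∈ range (n + 1), ∑ σ ∈ S132_3412 (n + 1) with permVal σ k = n,
      (Polynomial.X : Polynomial ℤ) ^ invStat σ := by
  choose p hp hpn using fun σ : Equiv.Perm (Fin (n + 1)) =>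
    exists_permVal_eq σ (Nat.lt_succ_self n)
  rw [V, ← sum_fiberwise_of_maps_to (g := p) (t := range (n + 1)) (by simpa using fun σ _ => hp σ)]
  refine sum_congr rfl fun k hk => sum_congr (filter_congr fun σ _ => ?_) fun _ _ => rfl
  refine ⟨fun h => h ▸ hpn σ, fun h => permVal_inj σ (hp σ) (mem_range.mp hk) ?_⟩
  rw [hpn, h]

lemma V_zero : V 0 = 1 := by
  have h : S132_3412 0 = univ := by
    ext σ
    simp only [mem_S132_3412_iff, Avoids, mem_univ, iff_true]
    exact ⟨by omega, by omega⟩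
  simp [V, h, invStat]

lemma V_one : V 1 = 1 := by
  rw [V_succ_eq_sum, sum_range_one, sum_maxCons, V_zero]
  simp

end PatternAvoid

/-- `V₀ = V₁ = 1` and, for `n ≥ 2`,
`Vₙ(q) = (q^(n-1) + 1) V_{n-1}(q) + Σ_{k=2}^{n-1} q^(k(n-k) + C(n-k,2)) V_{k-1}(q)`. -/
theorem stmt19 :
    V 0 = 1 ∧ V 1 = 1 ∧
      ∀ n : ℕ, 2 ≤ n →
        V n = (Polynomial.X ^ (n - 1) + 1) * V (n - 1) +
          ∑ k ∈ Finset.Icc 2 (n - 1),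
            Polynomial.X ^ (k * (n - k) + (n - k).choose 2) * V (k - 1) := by
  refine ⟨PatternAvoid.V_zero, PatternAvoid.V_one, fun n hn => ?_⟩
  obtain ⟨n, rfl⟩ : ∃ m, n = m + 1 := ⟨n - 1, by omega⟩
  have hsum : ∀ k ∈ Finset.Ico 1 (n + 1),
      ∑ σ ∈ S132_3412 (n + 1) with permVal σ k = n, (Polynomial.X : Polynomial ℤ) ^ invStat σ =
        Polynomial.X ^ ((k + 1) * (n - k) + (n - k).choose 2) * V k := by
    intro k hk
    rw [Finset.mem_Ico] at hk
    obtain ⟨r, rfl⟩ := Nat.exists_eq_add_of_le (show k ≤ n by omega)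
    rw [Nat.add_sub_cancel_left, ← PatternAvoid.sum_maxDecr r hk.1, Nat.add_right_comm]
  have hIcc : Finset.Icc 2 n = Finset.Ico (1 + 1) (n + 1) := by
    ext
    simp
  rw [PatternAvoid.V_succ_eq_sum, Finset.range_eq_Ico,
    Finset.sum_eq_sum_Ico_succ_bot (Nat.succ_pos n), PatternAvoid.sum_maxCons,
    Finset.sum_congr rfl hsum, Finset.sum_Ico_succ_top (by omega), Nat.add_sub_cancel, hIcc,
    ← Finset.sum_Ico_add']
  simp only [Nat.add_sub_cancel, Nat.add_sub_add_right, Nat.sub_self]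
  simp
  ring
end
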